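/- arXiv:2412.01355 — 2 statements merged into one kernel-verified Lean document; each statement's English description precedes it below -/
import Mathlib

section
/- Let H be a real Hilbert space and let Γ be a bounded, self-adjoint, nonnegative linear operator on H. For z ∈ H, one has λ(λI + Γ)⁻¹z → 0 in norm as λ → 0⁺ if and only if z belongs to the closure of the range of Γ. Consequently, λ(λI + Γ)⁻¹ converges to the zero operator in the strong operator topology as λ → 0⁺ if and only if Γ has dense range. -/
open scoped InnerProductSpace Topology

section Resolvent

variable {H : Type*} [NormedAddCommGroup H] [InnerProductSpace ℝ H]

lemma mul_norm_le_norm_smul_add_of_inner_nonneg {Γ : H →L[ℝ] H}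
    (hpos : ∀ x : H, 0 ≤ ⟪Γ x, x⟫_ℝ) (l : ℝ) (y : H) :
    l * ‖y‖ ≤ ‖l • y + Γ y‖ := by
  rcases (norm_nonneg y).eq_or_lt with hy | hy
  · simp [← hy]
  refine le_of_mul_le_mul_right ?_ hy
  calc l * ‖y‖ * ‖y‖ ≤ ⟪l • y + Γ y, y⟫_ℝ := by
        rw [inner_add_left, real_inner_smul_left, real_inner_self_eq_norm_mul_norm]
        linarith [hpos y]
    _ ≤ ‖l • y + Γ y‖ * ‖y‖ := real_inner_le_norm _ _

variable [CompleteSpace H] {Γ : H →L[ℝ] H} {l : ℝ}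

lemma isUnit_smul_one_add_of_inner_nonneg (hpos : ∀ x : H, 0 ≤ ⟪Γ x, x⟫_ℝ) (hl : 0 < l) :
    IsUnit (l • (1 : H →L[ℝ] H) + Γ) := by
  refine ContinuousLinearMap.isUnit_of_forall_le_norm_inner_map _ (c := ⟨l, hl.le⟩) hl fun x ↦ ?_
  refine le_trans ?_ (le_abs_self _)
  change ‖x‖ ^ 2 * l ≤ ⟪l • x + Γ x, x⟫_ℝ
  rw [inner_add_left, real_inner_smul_left, real_inner_self_eq_norm_sq]
  linarith [hpos x]

lemma smul_resolvent_add_apply (hpos : ∀ x : H, 0 ≤ ⟪Γ x, x⟫_ℝ) (hl : 0 < l) (z : H) :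
    l • Ring.inverse (l • (1 : H →L[ℝ] H) + Γ) z
      + Γ (Ring.inverse (l • (1 : H →L[ℝ] H) + Γ) z) = z := by
  simpa using DFunLike.congr_fun
    (Ring.mul_inverse_cancel _ (isUnit_smul_one_add_of_inner_nonneg hpos hl)) z

lemma resolvent_smul_add_apply (hpos : ∀ x : H, 0 ≤ ⟪Γ x, x⟫_ℝ) (hl : 0 < l) (x : H) :
    l • Ring.inverse (l • (1 : H →L[ℝ] H) + Γ) x
      + Ring.inverse (l • (1 : H →L[ℝ] H) + Γ) (Γ x) = x := by
  simpa using DFunLike.congr_fun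
    (Ring.inverse_mul_cancel _ (isUnit_smul_one_add_of_inner_nonneg hpos hl)) x

lemma norm_smul_resolvent_apply_le (hpos : ∀ x : H, 0 ≤ ⟪Γ x, x⟫_ℝ) (hl : 0 < l) (z : H) :
    ‖l • Ring.inverse (l • (1 : H →L[ℝ] H) + Γ) z‖ ≤ ‖z‖ := by
  have h := mul_norm_le_norm_smul_add_of_inner_nonneg hpos l
    (Ring.inverse (l • (1 : H →L[ℝ] H) + Γ) z)
  rwa [smul_resolvent_add_apply hpos hl, ← norm_smul_of_nonneg hl.le] at h

lemma norm_smul_resolvent_map_le (hpos : ∀ x : H, 0 ≤ ⟪Γ x, x⟫_ℝ) (hl : 0 < l) (x : H) :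
    ‖l • Ring.inverse (l • (1 : H →L[ℝ] H) + Γ) (Γ x)‖ ≤ l * (2 * ‖x‖) := by
  rw [eq_sub_of_add_eq' (resolvent_smul_add_apply hpos hl x), norm_smul_of_nonneg hl.le]
  gcongr
  linarith [norm_sub_le x (l • Ring.inverse (l • (1 : H →L[ℝ] H) + Γ) x),
    norm_smul_resolvent_apply_le hpos hl x]

lemma tendsto_smul_resolvent_iff (hpos : ∀ x : H, 0 ≤ ⟪Γ x, x⟫_ℝ) (z : H) :
    Filter.Tendsto (fun l : ℝ => (l • Ring.inverse (l • (1 : H →L[ℝ] H) + Γ)) z)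
      (𝓝[>] (0 : ℝ)) (𝓝 (0 : H)) ↔ z ∈ closure (Set.range Γ) := by
  constructor
  · intro h
    have hz := (tendsto_const_nhds (x := z)).sub h
    rw [sub_zero] at hz
    refine mem_closure_of_tendsto hz ?_
    filter_upwards [self_mem_nhdsWithin] with l hl
    exact ⟨_, eq_sub_of_add_eq' (smul_resolvent_add_apply hpos hl z)⟩
  · intro hz
    rw [Metric.tendsto_nhds]
    intro ε hε
    obtain ⟨_, ⟨x, rfl⟩, hx⟩ := Metric.mem_closure_iff.mp hz (ε / 2) (half_pos hε)
    rw [dist_eq_norm] at hx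
    have hsmall : Filter.Tendsto (fun l : ℝ => l * (2 * ‖x‖)) (𝓝[>] 0) (𝓝 0) :=
      ((continuous_id.mul continuous_const).tendsto' 0 0 (zero_mul _)).mono_left
        nhdsWithin_le_nhds
    filter_upwards [self_mem_nhdsWithin, hsmall.eventually_lt_const (half_pos hε)] with l hl hlx
    rw [dist_zero_right, ← sub_add_cancel z (Γ x), map_add]
    calc _ ≤ _ := norm_add_le _ _
      _ ≤ ‖z - Γ x‖ + l * (2 * ‖x‖) :=
        add_le_add (norm_smul_resolvent_apply_le hpos hl _) (norm_smul_resolvent_map_le hpos hl x)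
      _ < ε := by linarith

end Resolvent

/-- For a bounded nonnegative self-adjoint operator `Γ` on a real Hilbert space,
`l•(l•I + Γ)⁻¹ z → 0` as `l → 0⁺` iff `z` lies in the closure of the range of `Γ`;
consequently `l•(l•I + Γ)⁻¹ → 0` in the strong operator topology iff `Γ` has dense range. -/
theorem resolvent_tendsto_zero_iff_mem_closure_range
    {H : Type*} [NormedAddCommGroup H] [InnerProductSpace ℝ H] [CompleteSpace H]
    (Γ : H →L[ℝ] H) (hsa : IsSelfAdjoint Γ) (hpos : ∀ x : H, 0 ≤ ⟪Γ x, x⟫_ℝ) :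
    (∀ z : H,
      Filter.Tendsto (fun l : ℝ => (l • Ring.inverse (l • (1 : H →L[ℝ] H) + Γ)) z)
        (𝓝[>] (0 : ℝ)) (𝓝 (0 : H)) ↔ z ∈ closure (Set.range Γ)) ∧
    ((∀ z : H,
      Filter.Tendsto (fun l : ℝ => (l • Ring.inverse (l • (1 : H →L[ℝ] H) + Γ)) z)
        (𝓝[>] (0 : ℝ)) (𝓝 (0 : H))) ↔ DenseRange Γ) := by
  exact ⟨tendsto_smul_resolvent_iff hpos, forall_congr' (tendsto_smul_resolvent_iff hpos)⟩
end

section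
/- Let H₁ and H₂ be real Hilbert spaces and let M : H₁ → H₂ be a bounded linear operator with adjoint M*. Then the range of M is dense in H₂ if and only if for every z ∈ H₂, λ(λI + MM*)⁻¹z → 0 in norm as λ → 0⁺. -/
open scoped InnerProductSpace Topology

section

variable {H₁ H₂ : Type*}
  [NormedAddCommGroup H₁] [InnerProductSpace ℝ H₁] [CompleteSpace H₁]
  [NormedAddCommGroup H₂] [InnerProductSpace ℝ H₂] [CompleteSpace H₂]

theorem isUnit_smul_one_add_comp_adjoint (M : H₁ →L[ℝ] H₂) {l : ℝ} (hl : 0 < l) :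
    IsUnit (l • (1 : H₂ →L[ℝ] H₂) + M.comp M.adjoint) := by
  refine ContinuousLinearMap.isUnit_of_forall_le_norm_inner_map (c := ⟨l, hl.le⟩) _
    (by exact_mod_cast hl) fun x => ?_
  refine le_trans ?_ (le_abs_self _)
  simp only [add_apply, smul_apply, one_apply_eq_self, ContinuousLinearMap.comp_apply,
    inner_add_left, real_inner_smul_left, real_inner_self_eq_norm_sq,
    ← ContinuousLinearMap.adjoint_inner_right M (M.adjoint x)]
  change ‖x‖ ^ 2 * l ≤ _
  nlinarith [sq_nonneg ‖M.adjoint x‖]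

/-- The norm bound for a solution `w` of the regularized equation `l • w + M M* w = z`. -/
theorem norm_smul_sq_le_of_smul_add_comp_adjoint_eq (M : H₁ →L[ℝ] H₂) {l : ℝ} (hl : 0 < l)
    {w z : H₂} (h : l • w + M (M.adjoint w) = z) (u : H₁) :
    ‖l • w‖ ^ 2 ≤ ‖z - M u‖ ^ 2 + l * ‖u‖ ^ 2 := by
  have h₁ : l * ‖w‖ ^ 2 + ‖M.adjoint w‖ ^ 2 = ⟪z - M u, w⟫_ℝ + ⟪u, M.adjoint w⟫_ℝ := by
    rw [← h, ContinuousLinearMap.adjoint_inner_right, inner_sub_left, inner_add_left,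
      real_inner_smul_left, real_inner_self_eq_norm_sq,
      ← ContinuousLinearMap.adjoint_inner_right M (M.adjoint w), real_inner_self_eq_norm_sq]
    ring
  have h₂ := real_inner_le_norm (z - M u) w
  have h₃ := real_inner_le_norm u (M.adjoint w)
  have h₄ : l * ‖w‖ ^ 2 ≤ ‖z - M u‖ * ‖w‖ + ‖u‖ ^ 2 / 4 := by
    nlinarith [sq_nonneg (‖u‖ / 2 - ‖M.adjoint w‖)]
  have h₅ := mul_le_mul_of_nonneg_left h₄ hl.le
  rw [norm_smul, Real.norm_of_nonneg hl.le]
  nlinarith [sq_nonneg (‖z - M u‖ - l * ‖w‖), mul_nonneg hl.le (sq_nonneg ‖u‖)]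

end

/-- A bounded linear operator `M` between real Hilbert spaces has dense range
iff `l•(l•I + M M*)⁻¹ z → 0` in norm as `l → 0⁺` for every `z`. -/
theorem denseRange_iff_resolvent_tendsto_zero
    {H₁ H₂ : Type*}
    [NormedAddCommGroup H₁] [InnerProductSpace ℝ H₁] [CompleteSpace H₁]
    [NormedAddCommGroup H₂] [InnerProductSpace ℝ H₂] [CompleteSpace H₂]
    (M : H₁ →L[ℝ] H₂) :
    DenseRange M ↔
      ∀ z : H₂,
        Filter.Tendsto
          (fun l : ℝ => (l • Ring.inverse (l • (1 : H₂ →L[ℝ] H₂) + M.comp M.adjoint)) z)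
          (𝓝[>] (0 : ℝ)) (𝓝 (0 : H₂)) := by
  constructor
  · intro hM z
    rw [Metric.tendsto_nhds]
    intro ε hε
    obtain ⟨u, hu⟩ := hM.exists_dist_lt z (half_pos hε)
    rw [dist_eq_norm] at hu
    have hsmall : ∀ᶠ l : ℝ in 𝓝[>] 0, l * ‖u‖ ^ 2 < ε ^ 2 / 2 := by
      have ht : Filter.Tendsto (fun l : ℝ => l * ‖u‖ ^ 2) (𝓝[>] 0) (𝓝 (0 * ‖u‖ ^ 2)) :=
        ((continuous_id.mul continuous_const).tendsto 0).mono_left nhdsWithin_le_nhds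
      rw [zero_mul] at ht
      exact ht.eventually_lt_const (by positivity)
    filter_upwards [hsmall, self_mem_nhdsWithin] with l hlu hl
    have h := congrArg (fun T : H₂ →L[ℝ] H₂ => T z)
      (Ring.mul_inverse_cancel _ (isUnit_smul_one_add_comp_adjoint M hl))
    have hb := norm_smul_sq_le_of_smul_add_comp_adjoint_eq M hl (z := z) h u
    rw [dist_zero_right]
    refine lt_of_pow_lt_pow_left₀ 2 hε.le (hb.trans_lt ?_)
    nlinarith [norm_nonneg (z - M u)]
  · intro h
    have hrange : M.rangeᗮ = ⊥ := by
      rw [Submodule.eq_bot_iff]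
      intro y hy
      rw [ContinuousLinearMap.orthogonal_range] at hy
      have hy : M.adjoint y = 0 := hy
      refine tendsto_nhds_unique (tendsto_const_nhds.congr' ?_) (h y)
      filter_upwards [self_mem_nhdsWithin] with l hl
      have hi := congrArg (fun T : H₂ →L[ℝ] H₂ => T y)
        (Ring.inverse_mul_cancel _ (isUnit_smul_one_add_comp_adjoint M hl))
      simpa [hy] using hi.symm
    rw [← Submodule.topologicalClosure_eq_top_iff] at hrange
    exact Submodule.dense_iff_topologicalClosure_eq_top.mpr hrange
end
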